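/- arXiv:2204.13389 — 4 statements merged into one kernel-verified Lean document; each statement's English description precedes it below -/
import Mathlib

section
/- Let T > 0 and let (Ω, 𝓕, P) be a probability space equipped with a filtration (𝓕_t)_{t ∈ [0,T]}. Let F be a reflexive separable Banach space, in the sense that the canonical isometric embedding of F into its double dual F** is surjective. Let Θ : [0,T] × Ω → (nonempty convex compact subsets of F) be a set-valued map that is (ℬ([0,T]) ⊗ 𝓕)-measurable and adapted, and let φ : [0,T] × Ω → F be a (ℬ([0,T]) ⊗ 𝓕)-measurable process that is adapted. Then there exists a (ℬ([0,T]) ⊗ 𝓕)-measurable adapted process θ : [0,T] × Ω → F such that for every (t, ω) ∈ [0,T] × Ω one has θ(t, ω) ∈ Θ(t, ω) and ‖θ(t, ω) − φ(t, ω)‖_F = dist_F(φ(t, ω), Θ(t, ω)) := inf_{y ∈ Θ(t,ω)} ‖φ(t, ω) − y‖_F. -/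
open MeasureTheory Set

open Metric TopologicalSpace

section NearestPoints

variable {E : Type*} [MetricSpace E]

/-- The points of `K` at minimal distance from `a`. -/
def nearestPoints (K : Set E) (a : E) : Set E :=
  {y ∈ K | edist a y ≤ infEDist a K}

theorem isCompact_nearestPoints {K : Set E} (hK : IsCompact K) (a : E) :
    IsCompact (nearestPoints K a) :=
  hK.inter_right (isClosed_le (f := fun y => edist a y) (by fun_prop) continuous_const)

theorem nearestPoints_inter_nonempty_iff {K : Set E} (hK : IsCompact K) (hne : K.Nonempty)
    (a : E) {C : Set E} (hC : IsClosed C) :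
    (nearestPoints K a ∩ C).Nonempty ↔ infEDist a (K ∩ C) ≤ infEDist a K := by
  constructor
  · rintro ⟨y, ⟨hyK, hy⟩, hyC⟩
    exact (infEDist_le_edist_of_mem (Set.mem_inter hyK hyC)).trans hy
  · intro h
    have hKC : (K ∩ C).Nonempty := by
      rw [Set.nonempty_iff_ne_empty]
      intro h0
      rw [h0, infEDist_empty, top_le_iff] at h
      exact infEDist_ne_top hne h
    obtain ⟨y, hy, hay⟩ := (hK.inter_right hC).exists_infEDist_eq_edist hKC a
    exact ⟨y, ⟨hy.1, hay ▸ h⟩, hy.2⟩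

theorem nearestPoints_nonempty {K : Set E} (hK : IsCompact K) (hne : K.Nonempty) (a : E) :
    (nearestPoints K a).Nonempty := by
  simpa using nearestPoints_inter_nonempty_iff hK hne a isClosed_univ

theorem edist_eq_of_mem_nearestPoints {K : Set E} {a y : E} (hy : y ∈ nearestPoints K a) :
    edist a y = infEDist a K :=
  le_antisymm hy.2 (infEDist_le_edist_of_mem hy.1)

/-- Successive restriction of `K` to its points nearest to `d 0`, `d 1`, and so on. -/
def iteratedNearest (d : ℕ → E) (K : Set E) : ℕ → Set E
  | 0 => K
  | n + 1 => nearestPoints (iteratedNearest d K n) (d n)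

theorem isCompact_iteratedNearest (d : ℕ → E) {K : Set E} (hK : IsCompact K) (n : ℕ) :
    IsCompact (iteratedNearest d K n) := by
  induction n with
  | zero => exact hK
  | succ n ih => exact isCompact_nearestPoints ih _

theorem iteratedNearest_nonempty (d : ℕ → E) {K : Set E} (hK : IsCompact K) (hne : K.Nonempty)
    (n : ℕ) : (iteratedNearest d K n).Nonempty := by
  induction n with
  | zero => exact hne
  | succ n ih => exact nearestPoints_nonempty (isCompact_iteratedNearest d hK n) ih _

theorem iteratedNearest_succ_subset (d : ℕ → E) (K : Set E) (n : ℕ) :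
    iteratedNearest d K (n + 1) ⊆ iteratedNearest d K n :=
  fun _ hy => hy.1

theorem iInter_iteratedNearest_inter_nonempty_iff (d : ℕ → E) {K : Set E} (hK : IsCompact K)
    {C : Set E} (hC : IsClosed C) :
    ((⋂ n, iteratedNearest d K n) ∩ C).Nonempty ↔
      ∀ n, (iteratedNearest d K n ∩ C).Nonempty := by
  constructor
  · rintro ⟨y, hy, hyC⟩ n
    exact ⟨y, Set.mem_iInter.1 hy n, hyC⟩
  · intro h
    rw [Set.iInter_inter]
    exact IsCompact.nonempty_iInter_of_sequence_nonempty_isCompact_isClosed _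
      (fun n => Set.inter_subset_inter_left _ (iteratedNearest_succ_subset d K n)) h
      (hK.inter_right hC)
      (fun n => (isCompact_iteratedNearest d hK n).isClosed.inter hC)

theorem subsingleton_iInter_iteratedNearest {d : ℕ → E} (hd : DenseRange d) (K : Set E) :
    (⋂ n, iteratedNearest d K n).Subsingleton := by
  intro x hx y hy
  have h : (fun a => edist a x) = fun a => edist a y := by
    refine hd.equalizer (by fun_prop) (by fun_prop) (funext fun n => ?_)
    exact (edist_eq_of_mem_nearestPoints (Set.mem_iInter.1 hx (n + 1))).trans
      (edist_eq_of_mem_nearestPoints (Set.mem_iInter.1 hy (n + 1))).symm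
  exact (edist_eq_zero.1 ((congrFun h y).trans (edist_self y))).symm

theorem infEDist_eq_iInf_of_denseRange {d : ℕ → E} (hd : DenseRange d) (a : E) (K : Set E) :
    infEDist a K = ⨅ n, (edist a (d n) + infEDist (d n) K) := by
  refine le_antisymm (le_iInf fun n => ?_) ?_
  · rw [add_comm]
    exact infEDist_le_infEDist_add_edist
  · refine ENNReal.le_of_forall_pos_le_add fun ε hε _ => ?_
    have hε2 : (0 : ENNReal) < ε / 2 := ENNReal.half_pos (by simpa using hε.ne')
    obtain ⟨_, ⟨n, rfl⟩, hn⟩ := EMetric.mem_closure_iff.1 (hd a) (ε / 2) hε2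
    calc ⨅ n, (edist a (d n) + infEDist (d n) K)
        ≤ edist a (d n) + infEDist (d n) K := iInf_le _ n
      _ ≤ edist a (d n) + (infEDist a K + edist (d n) a) := by
          gcongr
          exact infEDist_le_infEDist_add_edist
      _ = infEDist a K + (edist a (d n) + edist a (d n)) := by
          rw [edist_comm (d n) a]; ring
      _ ≤ infEDist a K + (ε / 2 + ε / 2) := by gcongr
      _ = infEDist a K + ε := by rw [ENNReal.add_halves]

variable [SeparableSpace E] [Nonempty E]

/-- A point of `K` selected by successively minimizing the distance to a dense sequence. -/
noncomputable def compactSelector (K : Set E) : E :=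
  Classical.epsilon (· ∈ ⋂ n, iteratedNearest (denseSeq E) K n)

theorem compactSelector_mem_iInter {K : Set E} (hK : IsCompact K)
    (hne : K.Nonempty) : compactSelector K ∈ ⋂ n, iteratedNearest (denseSeq E) K n := by
  have h : (⋂ n, iteratedNearest (denseSeq E) K n).Nonempty := by
    simpa using (iInter_iteratedNearest_inter_nonempty_iff (denseSeq E) hK isClosed_univ).2
      fun n => by simpa using iteratedNearest_nonempty (denseSeq E) hK hne n
  exact Classical.epsilon_spec h

theorem compactSelector_mem {K : Set E} (hK : IsCompact K) (hne : K.Nonempty) :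
    compactSelector K ∈ K :=
  Set.mem_iInter.1 (compactSelector_mem_iInter hK hne) 0

end NearestPoints

section HitMeasurable

variable {X E : Type*} [MeasurableSpace X] [MetricSpace E]

/-- A set-valued map is hit-measurable if the set of parameters at which its value meets a given
closed set is always measurable. -/
def HitMeasurable (Φ : X → Set E) : Prop :=
  ∀ C, IsClosed C → MeasurableSet {x | (Φ x ∩ C).Nonempty}

theorem HitMeasurable.of_isOpen {Φ : X → Set E} (hΦc : ∀ x, IsCompact (Φ x))
    (hΦ : ∀ O, IsOpen O → MeasurableSet {x | (Φ x ∩ O).Nonempty}) : HitMeasurable Φ := by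
  intro C hC
  have h : {x | (Φ x ∩ C).Nonempty} =
      ⋂ n : ℕ, {x | (Φ x ∩ thickening (1 / ((n : ℝ) + 1)) C).Nonempty} := by
    ext x
    simp only [Set.mem_ofPred_eq, Set.mem_iInter]
    refine ⟨fun h n => h.mono (Set.inter_subset_inter_right _
      (self_subset_thickening Nat.one_div_pos_of_nat C)), fun h => ?_⟩
    by_contra hdisj
    rw [Set.not_nonempty_iff_eq_empty, ← Set.disjoint_iff_inter_eq_empty] at hdisj
    obtain ⟨δ, hδ, hthick⟩ := hdisj.exists_thickenings (hΦc x) hC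
    obtain ⟨n, hn⟩ := exists_nat_one_div_lt hδ
    obtain ⟨y, hyK, hyC⟩ := h n
    exact Set.disjoint_left.1 hthick (self_subset_thickening hδ _ hyK)
      (thickening_mono hn.le C hyC)
  rw [h]
  exact MeasurableSet.iInter fun n => hΦ _ isOpen_thickening

theorem HitMeasurable.measurableSet_of_isOpen {Φ : X → Set E} (hΦ : HitMeasurable Φ) {O : Set E}
    (hO : IsOpen O) : MeasurableSet {x | (Φ x ∩ O).Nonempty} := by
  obtain ⟨C, hC, -, hCO, -⟩ := hO.exists_iUnion_isClosed
  have h : {x | (Φ x ∩ O).Nonempty} = ⋃ n, {x | (Φ x ∩ C n).Nonempty} := by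
    ext x
    simp [← hCO, Set.inter_iUnion]
  rw [h]
  exact MeasurableSet.iUnion fun n => hΦ _ (hC n)

theorem HitMeasurable.inter {Φ : X → Set E} (hΦ : HitMeasurable Φ) {C : Set E}
    (hC : IsClosed C) : HitMeasurable fun x => Φ x ∩ C := by
  intro D hD
  simpa only [Set.inter_assoc] using hΦ _ (hC.inter hD)

theorem HitMeasurable.measurable_infEDist_const {Φ : X → Set E} (hΦ : HitMeasurable Φ) (a : E) :
    Measurable fun x => infEDist a (Φ x) := by
  refine measurable_of_Iio fun r => ?_
  have h : (fun x => infEDist a (Φ x)) ⁻¹' Set.Iio r =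
      {x | (Φ x ∩ eball a r).Nonempty} := by
    ext x
    simp [infEDist_lt_iff, Set.Nonempty, edist_comm a]
  rw [h]
  exact hΦ.measurableSet_of_isOpen isOpen_eball

variable [SeparableSpace E] [MeasurableSpace E] [BorelSpace E]

theorem HitMeasurable.measurable_infEDist {Φ : X → Set E} (hΦ : HitMeasurable Φ) {f : X → E}
    (hf : Measurable f) : Measurable fun x => infEDist (f x) (Φ x) := by
  rcases isEmpty_or_nonempty E with hE | hE
  · have : IsEmpty X := ⟨fun x => hE.elim (f x)⟩
    exact measurable_of_empty _
  have h : (fun x => infEDist (f x) (Φ x)) = fun x =>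
      ⨅ n, (edist (f x) (denseSeq E n) + infEDist (denseSeq E n) (Φ x)) :=
    funext fun x => infEDist_eq_iInf_of_denseRange (denseRange_denseSeq E) _ _
  rw [h]
  exact Measurable.iInf fun n =>
    (hf.edist measurable_const).add (hΦ.measurable_infEDist_const _)

theorem HitMeasurable.nearestPoints_of_measurable {Φ : X → Set E} (hΦ : HitMeasurable Φ)
    (hΦc : ∀ x, IsCompact (Φ x)) (hΦne : ∀ x, (Φ x).Nonempty) {f : X → E} (hf : Measurable f) :
    HitMeasurable fun x => nearestPoints (Φ x) (f x) := by
  intro C hC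
  simp_rw [nearestPoints_inter_nonempty_iff (hΦc _) (hΦne _) _ hC]
  exact measurableSet_le ((hΦ.inter hC).measurable_infEDist hf) (hΦ.measurable_infEDist hf)

theorem HitMeasurable.iteratedNearest_const {Φ : X → Set E} (hΦ : HitMeasurable Φ)
    (hΦc : ∀ x, IsCompact (Φ x)) (hΦne : ∀ x, (Φ x).Nonempty) (d : ℕ → E) (n : ℕ) :
    HitMeasurable fun x => iteratedNearest d (Φ x) n := by
  induction n with
  | zero => exact hΦ
  | succ n ih =>
    exact ih.nearestPoints_of_measurable (fun x => isCompact_iteratedNearest d (hΦc x) n)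
      (fun x => iteratedNearest_nonempty d (hΦc x) (hΦne x) n) measurable_const

theorem HitMeasurable.measurable_compactSelector [Nonempty E] {Φ : X → Set E}
    (hΦ : HitMeasurable Φ) (hΦc : ∀ x, IsCompact (Φ x)) (hΦne : ∀ x, (Φ x).Nonempty) :
    Measurable fun x => compactSelector (Φ x) := by
  refine measurable_of_isClosed fun C hC => ?_
  have h : (fun x => compactSelector (Φ x)) ⁻¹' C =
      ⋂ n, {x | (iteratedNearest (denseSeq E) (Φ x) n ∩ C).Nonempty} := by
    ext x
    have hmem := compactSelector_mem_iInter (hΦc x) (hΦne x)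
    simp only [Set.mem_preimage, Set.mem_iInter, Set.mem_ofPred_eq]
    rw [← iInter_iteratedNearest_inter_nonempty_iff _ (hΦc x) hC]
    refine ⟨fun h => ⟨_, hmem, h⟩, ?_⟩
    rintro ⟨y, hy, hyC⟩
    rwa [subsingleton_iInter_iteratedNearest (denseRange_denseSeq E) (Φ x) hmem hy]
  rw [h]
  exact MeasurableSet.iInter fun n => hΦ.iteratedNearest_const hΦc hΦne _ n C hC

theorem measurable_compactSelector_nearestPoints [Nonempty E] {Φ : X → Set E}
    (hΦ : ∀ O, IsOpen O → MeasurableSet {x | (Φ x ∩ O).Nonempty})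
    (hΦc : ∀ x, IsCompact (Φ x)) (hΦne : ∀ x, (Φ x).Nonempty) {f : X → E} (hf : Measurable f) :
    Measurable fun x => compactSelector (nearestPoints (Φ x) (f x)) :=
  ((HitMeasurable.of_isOpen hΦc hΦ).nearestPoints_of_measurable hΦc hΦne hf).measurable_compactSelector
    (fun x => isCompact_nearestPoints (hΦc x) _) (fun x => nearestPoints_nonempty (hΦc x) (hΦne x) _)

end HitMeasurable


/-- Measurable adapted metric projection onto a measurable adapted
set-valued map with nonempty convex compact values in a reflexive separable Banach space. -/
theorem statement1
    {Ω : Type*} [mΩ : MeasurableSpace Ω]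
    (P : Measure Ω) [IsProbabilityMeasure P]
    (T : ℝ) (hT : 0 < T)
    (ℱ : Set.Icc (0:ℝ) T → MeasurableSpace Ω)
    (hℱmono : Monotone ℱ) (hℱle : ∀ t, ℱ t ≤ mΩ)
    {F : Type*} [NormedAddCommGroup F] [NormedSpace ℝ F] [CompleteSpace F]
    [TopologicalSpace.SeparableSpace F] [MeasurableSpace F] [BorelSpace F]
    (hrefl : Function.Surjective (NormedSpace.inclusionInDoubleDual ℝ F))
    (Θ : Set.Icc (0:ℝ) T × Ω → Set F)
    (hΘne : ∀ q, (Θ q).Nonempty)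
    (hΘconv : ∀ q, Convex ℝ (Θ q))
    (hΘcomp : ∀ q, IsCompact (Θ q))
    (hΘmeas : ∀ O : Set F, IsOpen O → MeasurableSet {q | (Θ q ∩ O).Nonempty})
    (hΘadap : ∀ t, ∀ O : Set F, IsOpen O →
      MeasurableSet[ℱ t] {ω | (Θ (t, ω) ∩ O).Nonempty})
    (φ : Set.Icc (0:ℝ) T × Ω → F)
    (hφmeas : Measurable φ)
    (hφadap : ∀ t, Measurable[ℱ t] fun ω => φ (t, ω)) :
    ∃ θ : Set.Icc (0:ℝ) T × Ω → F,
      Measurable θ ∧ (∀ t, Measurable[ℱ t] fun ω => θ (t, ω)) ∧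
      ∀ q, θ q ∈ Θ q ∧ ‖θ q - φ q‖ = Metric.infDist (φ q) (Θ q) := by
  refine ⟨fun q => compactSelector (nearestPoints (Θ q) (φ q)),
    measurable_compactSelector_nearestPoints hΘmeas hΘcomp hΘne hφmeas,
    fun t => @measurable_compactSelector_nearestPoints _ _ (ℱ t) _ _ _ _ _ _ (hΘadap t)
      (fun _ => hΘcomp _) (fun _ => hΘne _) _ (hφadap t), fun q => ?_⟩
  have h := compactSelector_mem (isCompact_nearestPoints (hΘcomp q) (φ q))
    (nearestPoints_nonempty (hΘcomp q) (hΘne q) (φ q))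
  refine ⟨h.1, ?_⟩
  rw [Metric.infDist, ← edist_eq_of_mem_nearestPoints h, ← dist_edist, dist_comm, dist_eq_norm]
end

section
/- Let T > 0, let (Ω, 𝓕, P) be a probability space with a filtration (𝓕_t)_{t ∈ [0,T]}, and let Σ := ⋂_{t ∈ [0,T]} { A ∈ ℬ([0,T]) ⊗ 𝓕 : A_t ∈ 𝓕_t }, where A_t = { ω : (t, ω) ∈ A }. Let E be a separable Banach space and let G : [0,T] × Ω × E × E → (nonempty closed subsets of E) be a set-valued map that is (Σ ⊗ ℬ(E) ⊗ ℬ(E))-measurable. If Y, Z : [0,T] × Ω → E are (ℬ([0,T]) ⊗ 𝓕)-measurable adapted processes, then the set-valued map (t, ω) ↦ G(t, ω, Y(t, ω), Z(t, ω)) is (ℬ([0,T]) ⊗ 𝓕)-measurable and adapted, i.e. for every open O ⊆ E the set {(t, ω) : G(t, ω, Y(t,ω), Z(t,ω)) ∩ O ≠ ∅} belongs to ℬ([0,T]) ⊗ 𝓕 and, for every t ∈ [0,T], the set {ω : G(t, ω, Y(t,ω), Z(t,ω)) ∩ O ≠ ∅} belongs to 𝓕_t. -/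
open MeasureTheory Set

/-- The σ-algebra `Σ = ⋂_{t∈[0,T]} {A ∈ ℬ([0,T]) ⊗ 𝓕 : A_t ∈ 𝓕_t}` on `[0,T] × Ω`. -/
def progSigma {T : ℝ} {Ω : Type*} [mΩ : MeasurableSpace Ω]
    (ℱ : Set.Icc (0:ℝ) T → MeasurableSpace Ω) :
    MeasurableSpace (Set.Icc (0:ℝ) T × Ω) where
  MeasurableSet' A := MeasurableSet A ∧ ∀ t, MeasurableSet[ℱ t] {ω | (t, ω) ∈ A}
  measurableSet_empty :=
    ⟨MeasurableSet.empty, fun t => @MeasurableSet.empty Ω (ℱ t)⟩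
  measurableSet_compl := fun A hA =>
    ⟨hA.1.compl, fun t => by
      have : {ω | (t, ω) ∈ Aᶜ} = {ω | (t, ω) ∈ A}ᶜ := rfl
      rw [this]; exact (hA.2 t).compl⟩
  measurableSet_iUnion := fun f hf =>
    ⟨MeasurableSet.iUnion fun i => (hf i).1, fun t => by
      have : {ω | (t, ω) ∈ ⋃ i, f i} = ⋃ i, {ω | (t, ω) ∈ f i} := by
        ext ω; simp
      rw [this]; exact MeasurableSet.iUnion fun i => (hf i).2 t⟩

/-- A measurable adapted process is measurable with respect to `progSigma ℱ`. -/
theorem measurable_progSigma {T : ℝ} {Ω : Type*} [MeasurableSpace Ω]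
    {ℱ : Set.Icc (0:ℝ) T → MeasurableSpace Ω} {F : Type*} [MeasurableSpace F]
    {Y : Set.Icc (0:ℝ) T × Ω → F} (hY : Measurable Y)
    (hYadap : ∀ t, Measurable[ℱ t] fun ω => Y (t, ω)) :
    Measurable[progSigma ℱ] Y :=
  fun _ hs => ⟨hY hs, fun t => hYadap t hs⟩

/-- If `G` is a `Σ ⊗ ℬ(E) ⊗ ℬ(E)`-measurable set-valued map with nonempty
closed values and `Y, Z` are measurable adapted processes, then
`(t,ω) ↦ G(t, ω, Y(t,ω), Z(t,ω))` is measurable and adapted. -/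
theorem statement6
    {Ω : Type*} [mΩ : MeasurableSpace Ω]
    (P : Measure Ω) [IsProbabilityMeasure P]
    (T : ℝ) (hT : 0 < T)
    (ℱ : Set.Icc (0:ℝ) T → MeasurableSpace Ω)
    (hℱmono : Monotone ℱ) (hℱle : ∀ t, ℱ t ≤ mΩ)
    {E : Type*} [NormedAddCommGroup E] [NormedSpace ℝ E] [CompleteSpace E]
    [TopologicalSpace.SeparableSpace E] [MeasurableSpace E] [BorelSpace E]
    (G : (Set.Icc (0:ℝ) T × Ω) × E × E → Set E)
    (hGne : ∀ q, (G q).Nonempty)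
    (hGcl : ∀ q, IsClosed (G q))
    (hGmeas : ∀ O : Set E, IsOpen O →
      MeasurableSet[(progSigma ℱ).prod inferInstance] {q | (G q ∩ O).Nonempty})
    (Y Z : Set.Icc (0:ℝ) T × Ω → E)
    (hYmeas : Measurable Y) (hYadap : ∀ t, Measurable[ℱ t] fun ω => Y (t, ω))
    (hZmeas : Measurable Z) (hZadap : ∀ t, Measurable[ℱ t] fun ω => Z (t, ω)) :
    ∀ O : Set E, IsOpen O →
      MeasurableSet {p | (G (p, Y p, Z p) ∩ O).Nonempty} ∧
      ∀ t, MeasurableSet[ℱ t] {ω | (G ((t, ω), Y (t, ω), Z (t, ω)) ∩ O).Nonempty} := by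
  intro O hO
  have hYZ : Measurable[progSigma ℱ] fun p => (Y p, Z p) :=
    measurable_progSigma (hYmeas.prodMk hZmeas) fun t =>
      (hYadap t).prodMk (hZadap t)
  have hgraph : @Measurable _ _ (progSigma ℱ) ((progSigma ℱ).prod inferInstance)
      fun p => (p, Y p, Z p) :=
    (@measurable_id _ (progSigma ℱ)).prodMk hYZ
  exact hgraph (hGmeas O hO)
end

section
/- Let T > 0, let (Ω, 𝓕, P) be a probability space with a filtration (𝓕_t)_{t ∈ [0,T]}, and let Σ := ⋂_{t ∈ [0,T]} { A ∈ ℬ([0,T]) ⊗ 𝓕 : A_t ∈ 𝓕_t }, where A_t = { ω : (t, ω) ∈ A }. Let E be a separable Banach space and let G : [0,T] × Ω × E × E → (nonempty convex compact subsets of E) be a (Σ ⊗ ℬ(E) ⊗ ℬ(E))-measurable set-valued map. If Y, Z : [0,T] × Ω → E are (ℬ([0,T]) ⊗ 𝓕)-measurable adapted processes, then there exists a (ℬ([0,T]) ⊗ 𝓕)-measurable adapted process h : [0,T] × Ω → E such that h(t, ω) ∈ G(t, ω, Y(t, ω), Z(t, ω)) for every (t, ω) ∈ [0,T] × Ω.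 -/
open MeasureTheory Set

/-- The refinement step in the Kuratowski–Ryll-Nardzewski construction: an approximate selection
with values in a dense sequence can be improved to any prescribed precision. -/
lemma exists_measurable_refinement {X E : Type*} [MeasurableSpace X] [PseudoMetricSpace E]
    {F : X → Set E} (hF : ∀ O : Set E, IsOpen O → MeasurableSet {x | (F x ∩ O).Nonempty})
    {d : ℕ → E} (hd : DenseRange d) {i : X → ℕ} (hi : Measurable i) {r s : ℝ} (hs : 0 < s)
    (hir : ∀ x, (F x ∩ Metric.ball (d (i x)) r).Nonempty) :
    ∃ j : X → ℕ, Measurable j ∧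
      ∀ x, (F x ∩ (Metric.ball (d (i x)) r ∩ Metric.ball (d (j x)) s)).Nonempty := by
  classical
  have hex : ∀ x, ∃ k, (F x ∩ (Metric.ball (d (i x)) r ∩ Metric.ball (d k) s)).Nonempty := by
    intro x
    obtain ⟨y, hyF, hy⟩ := hir x
    obtain ⟨k, hk⟩ := hd.exists_dist_lt y hs
    exact ⟨k, y, hyF, hy, hk⟩
  refine ⟨fun x => Nat.find (hex x), measurable_find hex fun k => ?_,
    fun x => Nat.find_spec (hex x)⟩
  have heq : {x | (F x ∩ (Metric.ball (d (i x)) r ∩ Metric.ball (d k) s)).Nonempty} =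
      ⋃ l, i ⁻¹' {l} ∩ {x | (F x ∩ (Metric.ball (d l) r ∩ Metric.ball (d k) s)).Nonempty} := by
    ext x
    simp
  rw [heq]
  exact MeasurableSet.iUnion fun l => (hi (measurableSet_singleton l)).inter
    (hF _ (Metric.isOpen_ball.inter Metric.isOpen_ball))

/-- The **Kuratowski–Ryll-Nardzewski selection theorem**: a measurable set-valued map with
nonempty closed values in a complete separable metric space has a measurable selection. -/
theorem exists_measurable_selection {X E : Type*} [MeasurableSpace X] [MetricSpace E]
    [CompleteSpace E] [TopologicalSpace.SeparableSpace E] [MeasurableSpace E] [BorelSpace E]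
    {F : X → Set E} (hne : ∀ x, (F x).Nonempty) (hclosed : ∀ x, IsClosed (F x))
    (hF : ∀ O : Set E, IsOpen O → MeasurableSet {x | (F x ∩ O).Nonempty}) :
    ∃ f : X → E, Measurable f ∧ ∀ x, f x ∈ F x := by
  classical
  rcases isEmpty_or_nonempty X with hX | ⟨⟨x₀⟩⟩
  · exact ⟨isEmptyElim, measurable_of_empty _, isEmptyElim⟩
  have : Nonempty E := ⟨(hne x₀).some⟩
  let d := TopologicalSpace.denseSeq E
  have hd : DenseRange d := TopologicalSpace.denseRange_denseSeq E
  let A (n : ℕ) := {i : X → ℕ // Measurable i ∧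
    ∀ x, (F x ∩ Metric.ball (d (i x)) ((1 / 2) ^ n)).Nonempty}
  have hstart : Nonempty (A 0) := by
    have hex : ∀ x, ∃ k, (F x ∩ Metric.ball (d k) ((1 / 2) ^ 0)).Nonempty := by
      intro x
      obtain ⟨y, hy⟩ := hne x
      obtain ⟨k, hk⟩ := hd.exists_dist_lt y (show (0 : ℝ) < (1 / 2) ^ 0 by positivity)
      exact ⟨k, y, hy, hk⟩
    exact ⟨fun x => Nat.find (hex x), measurable_find hex fun k => hF _ Metric.isOpen_ball,
      fun x => Nat.find_spec (hex x)⟩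
  have hstep : ∀ n (i : A n), ∃ j : A (n + 1), ∀ x,
      (F x ∩ (Metric.ball (d (i.1 x)) ((1 / 2) ^ n) ∩
        Metric.ball (d (j.1 x)) ((1 / 2) ^ (n + 1)))).Nonempty := by
    intro n i
    obtain ⟨j, hj, hij⟩ := exists_measurable_refinement hF hd i.2.1
      (show (0 : ℝ) < (1 / 2) ^ (n + 1) by positivity) i.2.2
    exact ⟨⟨j, hj, fun x => (hij x).mono fun y hy => ⟨hy.1, hy.2.2⟩⟩, hij⟩
  choose next hnext using hstep
  let a : ∀ n, A n := fun n => Nat.rec hstart.some next n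
  have hdist : ∀ x n, dist (d ((a n).1 x)) (d ((a (n + 1)).1 x)) ≤ 2 * (1 / 2) ^ n := by
    intro x n
    obtain ⟨y, -, hy₁, hy₂⟩ := hnext n (a n) x
    rw [Metric.mem_ball'] at hy₁
    rw [Metric.mem_ball] at hy₂
    have hpos : (0 : ℝ) < (1 / 2) ^ n := by positivity
    have hpow : ((1 : ℝ) / 2) ^ (n + 1) = (1 / 2) ^ n / 2 := by ring
    have htri := dist_triangle (d ((a n).1 x)) y (d ((a (n + 1)).1 x))
    change dist y (d ((a (n + 1)).1 x)) < _ at hy₂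
    linarith
  have hlim : ∀ x, ∃ y, Filter.Tendsto (fun n => d ((a n).1 x)) Filter.atTop (nhds y) :=
    fun x => cauchySeq_tendsto_of_complete
      (cauchySeq_of_le_geometric (1 / 2) 2 (by norm_num) (hdist x))
  choose f hf using hlim
  refine ⟨f, measurable_of_tendsto_metrizable (f := fun n x => d ((a n).1 x))
    (fun n => measurable_from_nat.comp (a n).2.1) (tendsto_pi_nhds.2 hf), fun x => ?_⟩
  choose y hyF hy using fun n => (a n).2.2 x
  refine (hclosed x).mem_of_tendsto (f := y) (b := Filter.atTop) ?_ (Filter.Eventually.of_forall hyF)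
  refine (hf x).congr_dist (squeeze_zero (fun _ => dist_nonneg)
    (fun n => (Metric.mem_ball'.1 (hy n)).le) ?_)
  exact tendsto_pow_atTop_nhds_zero_of_lt_one (by norm_num) (by norm_num)

/-- A process is `progSigma ℱ`-measurable iff it is jointly measurable and adapted. -/
lemma measurable_progSigma_iff {T : ℝ} {Ω E : Type*} [MeasurableSpace Ω] [MeasurableSpace E]
    {ℱ : Set.Icc (0 : ℝ) T → MeasurableSpace Ω} {Y : Set.Icc (0 : ℝ) T × Ω → E} :
    Measurable[progSigma ℱ] Y ↔ Measurable Y ∧ ∀ t, Measurable[ℱ t] fun ω => Y (t, ω) :=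
  ⟨fun h => ⟨fun _ hs => (h hs).1, fun t _ hs => (h hs).2 t⟩,
    fun h _ hs => ⟨h.1 hs, fun t => h.2 t hs⟩⟩

/-- If `G` is a `Σ ⊗ ℬ(E) ⊗ ℬ(E)`-measurable set-valued map with nonempty
convex compact values and `Y, Z` are measurable adapted processes, then there is a
measurable adapted selection `h` of `(t,ω) ↦ G(t, ω, Y(t,ω), Z(t,ω))`. -/
theorem statement7
    {Ω : Type*} [mΩ : MeasurableSpace Ω]
    (P : Measure Ω) [IsProbabilityMeasure P]
    (T : ℝ) (hT : 0 < T)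
    (ℱ : Set.Icc (0:ℝ) T → MeasurableSpace Ω)
    (hℱmono : Monotone ℱ) (hℱle : ∀ t, ℱ t ≤ mΩ)
    {E : Type*} [NormedAddCommGroup E] [NormedSpace ℝ E] [CompleteSpace E]
    [TopologicalSpace.SeparableSpace E] [MeasurableSpace E] [BorelSpace E]
    (G : (Set.Icc (0:ℝ) T × Ω) × E × E → Set E)
    (hGne : ∀ q, (G q).Nonempty)
    (hGconv : ∀ q, Convex ℝ (G q))
    (hGcomp : ∀ q, IsCompact (G q))
    (hGmeas : ∀ O : Set E, IsOpen O →
      MeasurableSet[(progSigma ℱ).prod inferInstance] {q | (G q ∩ O).Nonempty})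
    (Y Z : Set.Icc (0:ℝ) T × Ω → E)
    (hYmeas : Measurable Y) (hYadap : ∀ t, Measurable[ℱ t] fun ω => Y (t, ω))
    (hZmeas : Measurable Z) (hZadap : ∀ t, Measurable[ℱ t] fun ω => Z (t, ω)) :
    ∃ h : Set.Icc (0:ℝ) T × Ω → E,
      Measurable h ∧ (∀ t, Measurable[ℱ t] fun ω => h (t, ω)) ∧
      ∀ p, h p ∈ G (p, Y p, Z p) := by
  have hY := measurable_progSigma_iff.2 ⟨hYmeas, hYadap⟩
  have hZ := measurable_progSigma_iff.2 ⟨hZmeas, hZadap⟩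
  have hφ : Measurable[progSigma ℱ, (progSigma ℱ).prod inferInstance]
      fun p => (p, Y p, Z p) :=
    (@measurable_id _ (progSigma ℱ)).prodMk (hY.prodMk hZ)
  obtain ⟨h, hmeas, hsel⟩ := @exists_measurable_selection _ E (progSigma ℱ) _ _ _ _ _
    (fun p => G (p, Y p, Z p)) (fun p => hGne _) (fun p => (hGcomp _).isClosed)
    (fun O hO => hφ (hGmeas O hO))
  obtain ⟨hjoint, hadapted⟩ := measurable_progSigma_iff.1 hmeas
  exact ⟨h, hjoint, hadapted, hsel⟩
end

section
/- Let T > 0, let (Ω, 𝓕, P) be a probability space with a filtration (𝓕_t)_{t ∈ [0,T]}, and let E be a separable Hilbert space. Let G₁, G₂ : [0,T] × Ω → (nonempty convex compact subsets of E) be set-valued maps, each (ℬ([0,T]) ⊗ 𝓕)-measurable and adapted. Let g : [0,T] × Ω → E be a (ℬ([0,T]) ⊗ 𝓕)-measurable adapted process with g(t, ω) ∈ G₁(t, ω) for every (t, ω). Then there exists a (ℬ([0,T]) ⊗ 𝓕)-measurable adapted process h : [0,T] × Ω → E such that h(t, ω) ∈ G₂(t, ω) and ‖g(t, ω) − h(t,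 ω)‖_E ≤ ϱ(G₁(t, ω), G₂(t, ω)) for every (t, ω) ∈ [0,T] × Ω. -/
open MeasureTheory Set

/-- For a measurable set-valued map `Φ`, the set of points where `Φ` meets a fixed open set at
distance less than `a` from `g` is measurable. -/
theorem measurableSet_exists_mem_dist_lt {X E : Type*} {mX : MeasurableSpace X}
    [PseudoMetricSpace E] [TopologicalSpace.SeparableSpace E] [MeasurableSpace E] [BorelSpace E]
    {Φ : X → Set E} (hΦ : ∀ O : Set E, IsOpen O → MeasurableSet {q | (Φ q ∩ O).Nonempty})
    {g : X → E} (hg : Measurable g) {a : X → ℝ} (ha : Measurable a)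
    {U : Set E} (hU : IsOpen U) :
    MeasurableSet {q | ∃ x ∈ Φ q, x ∈ U ∧ dist x (g q) < a q} := by
  obtain ⟨D, hDc, hDd⟩ := TopologicalSpace.exists_countable_dense E
  have key : {q | ∃ x ∈ Φ q, x ∈ U ∧ dist x (g q) < a q} =
      ⋃ e ∈ D, ⋃ s : ℚ, {q | (Φ q ∩ (U ∩ Metric.ball e s)).Nonempty} ∩
        {q | dist (g q) e + s ≤ a q} := by
    ext q
    simp only [mem_ofPred_eq, mem_iUnion, mem_inter_iff, exists_prop]
    constructor
    · rintro ⟨x, hx, hxU, hxa⟩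
      obtain ⟨e, he, heD⟩ := Metric.dense_iff.1 hDd x ((a q - dist x (g q)) / 2) (by linarith)
      rw [Metric.mem_ball, dist_comm] at he
      have h1 := dist_triangle (g q) x e
      rw [dist_comm (g q) x] at h1
      obtain ⟨s, hs1, hs2⟩ := exists_rat_btwn
        (show dist x e < a q - dist (g q) e by linarith)
      exact ⟨e, heD, s, ⟨x, hx, hxU, hs1⟩, by linarith⟩
    · rintro ⟨e, -, s, ⟨x, hx, hxU, hxe⟩, hs⟩
      refine ⟨x, hx, hxU, ?_⟩
      have h1 := dist_triangle x e (g q)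
      rw [dist_comm e] at h1
      rw [Metric.mem_ball] at hxe
      linarith
  rw [key]
  refine MeasurableSet.biUnion hDc fun e _ => MeasurableSet.iUnion fun s => ?_
  exact (hΦ _ (hU.inter Metric.isOpen_ball)).inter
    (measurableSet_le ((hg.dist measurable_const).add_const _) ha)

theorem measurable_infDist_of_measurable_setValued {X E : Type*} {mX : MeasurableSpace X}
    [PseudoMetricSpace E] [TopologicalSpace.SeparableSpace E] [MeasurableSpace E] [BorelSpace E]
    {Φ : X → Set E} (hne : ∀ q, (Φ q).Nonempty)
    (hΦ : ∀ O : Set E, IsOpen O → MeasurableSet {q | (Φ q ∩ O).Nonempty})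
    {g : X → E} (hg : Measurable g) :
    Measurable fun q => Metric.infDist (g q) (Φ q) := by
  refine measurable_of_Iio fun r => ?_
  convert measurableSet_exists_mem_dist_lt hΦ hg (measurable_const (a := r)) isOpen_univ using 1
  ext q
  simp [Metric.infDist_lt_iff (hne q), dist_comm]

/-- A nearest-point selection of a measurable compact-valued map is measurable whenever the
nearest points are unique. -/
theorem measurable_of_unique_nearest {X E : Type*} {mX : MeasurableSpace X}
    [PseudoMetricSpace E] [TopologicalSpace.SeparableSpace E] [MeasurableSpace E] [BorelSpace E]
    {Φ : X → Set E} (hcomp : ∀ q, IsCompact (Φ q))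
    (hΦ : ∀ O : Set E, IsOpen O → MeasurableSet {q | (Φ q ∩ O).Nonempty})
    {g h : X → E} (hg : Measurable g) (hmem : ∀ q, h q ∈ Φ q)
    (hdist : ∀ q, dist (h q) (g q) = Metric.infDist (g q) (Φ q))
    (huniq : ∀ q, ∀ x ∈ Φ q, dist x (g q) ≤ Metric.infDist (g q) (Φ q) → x = h q) :
    Measurable h := by
  refine measurable_of_isClosed fun K hK => ?_
  have hpos : ∀ n : ℕ, (0 : ℝ) < 1 / (n + 1) := fun n => Nat.one_div_pos_of_nat
  have key : h ⁻¹' K = ⋂ n : ℕ, {q | ∃ x ∈ Φ q, x ∈ Metric.thickening (1 / ((n : ℝ) + 1)) K ∧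
      dist x (g q) < Metric.infDist (g q) (Φ q) + 1 / ((n : ℝ) + 1)} := by
    ext q
    simp only [mem_preimage, mem_iInter, mem_ofPred_eq]
    constructor
    · intro hq n
      exact ⟨h q, hmem q, Metric.self_subset_thickening (hpos n) K hq,
        by linarith [hdist q, hpos n]⟩
    · intro hq
      choose x hx hxK hxd using hq
      obtain ⟨y, hy, φ, hφ, hlim⟩ := (hcomp q).tendsto_subseq hx
      have h0 := tendsto_one_div_add_atTop_nhds_zero_nat (𝕜 := ℝ) |>.comp hφ.tendsto_atTop
      have hyd : dist y (g q) ≤ Metric.infDist (g q) (Φ q) := by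
        refine le_of_tendsto_of_tendsto' (hlim.dist tendsto_const_nhds)
          (by simpa using h0.const_add (Metric.infDist (g q) (Φ q))) fun n => (hxd (φ n)).le
      rw [← huniq q y hy hyd]
      obtain ⟨z, hz, -⟩ := Metric.mem_thickening_iff.1 (hxK 0)
      rw [hK.mem_iff_infDist_zero ⟨z, hz⟩]
      refine le_antisymm (le_of_tendsto_of_tendsto'
        (((Metric.continuous_infDist_pt K).tendsto y).comp hlim) h0 fun n => ?_)
        Metric.infDist_nonneg
      obtain ⟨w, hw, hxw⟩ := Metric.mem_thickening_iff.1 (hxK (φ n))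
      exact (Metric.infDist_le_dist_of_mem hw).trans hxw.le
  rw [key]
  exact MeasurableSet.iInter fun n => measurableSet_exists_mem_dist_lt hΦ hg
    ((measurable_infDist_of_measurable_setValued (fun q => ⟨_, hmem q⟩) hΦ hg).add_const _)
    Metric.isOpen_thickening

theorem Convex.eq_of_dist_le_infDist {E : Type*} [NormedAddCommGroup E] [NormedSpace ℝ E]
    [StrictConvexSpace ℝ E] {s : Set E} (hs : Convex ℝ s) {x y z : E} (hx : x ∈ s) (hy : y ∈ s)
    (hxz : dist x z ≤ Metric.infDist z s) (hyz : dist y z ≤ Metric.infDist z s) : x = y := by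
  by_contra hne
  have hball := combo_mem_ball_of_ne (a := 1 / 2) (b := 1 / 2) (Metric.mem_closedBall.2 hxz)
    (Metric.mem_closedBall.2 hyz) hne (by norm_num) (by norm_num) (by norm_num)
  rw [Metric.mem_ball, dist_comm] at hball
  exact (Metric.infDist_le_dist_of_mem
    (hs hx hy (by norm_num) (by norm_num) (by norm_num))).not_gt hball

/-- Given two measurable adapted set-valued maps `G₁, G₂` with nonempty
convex compact values in a separable Hilbert space and a measurable adapted selection `g`
of `G₁`, there is a measurable adapted selection `h` of `G₂` with
`‖g − h‖ ≤ ϱ(G₁, G₂)` pointwise, where `ϱ` is the Hausdorff distance. -/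
theorem statement8
    {Ω : Type*} [mΩ : MeasurableSpace Ω]
    (P : Measure Ω) [IsProbabilityMeasure P]
    (T : ℝ) (hT : 0 < T)
    (ℱ : Set.Icc (0:ℝ) T → MeasurableSpace Ω)
    (hℱmono : Monotone ℱ) (hℱle : ∀ t, ℱ t ≤ mΩ)
    {E : Type*} [NormedAddCommGroup E] [InnerProductSpace ℝ E] [CompleteSpace E]
    [TopologicalSpace.SeparableSpace E] [MeasurableSpace E] [BorelSpace E]
    (G₁ G₂ : Set.Icc (0:ℝ) T × Ω → Set E)
    (hG₁ne : ∀ q, (G₁ q).Nonempty) (hG₁conv : ∀ q, Convex ℝ (G₁ q))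
    (hG₁comp : ∀ q, IsCompact (G₁ q))
    (hG₁meas : ∀ O : Set E, IsOpen O → MeasurableSet {q | (G₁ q ∩ O).Nonempty})
    (hG₁adap : ∀ t, ∀ O : Set E, IsOpen O →
      MeasurableSet[ℱ t] {ω | (G₁ (t, ω) ∩ O).Nonempty})
    (hG₂ne : ∀ q, (G₂ q).Nonempty) (hG₂conv : ∀ q, Convex ℝ (G₂ q))
    (hG₂comp : ∀ q, IsCompact (G₂ q))
    (hG₂meas : ∀ O : Set E, IsOpen O → MeasurableSet {q | (G₂ q ∩ O).Nonempty})
    (hG₂adap : ∀ t, ∀ O : Set E, IsOpen O →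
      MeasurableSet[ℱ t] {ω | (G₂ (t, ω) ∩ O).Nonempty})
    (g : Set.Icc (0:ℝ) T × Ω → E)
    (hgmeas : Measurable g)
    (hgadap : ∀ t, Measurable[ℱ t] fun ω => g (t, ω))
    (hgsel : ∀ q, g q ∈ G₁ q) :
    ∃ h : Set.Icc (0:ℝ) T × Ω → E,
      Measurable h ∧ (∀ t, Measurable[ℱ t] fun ω => h (t, ω)) ∧
      ∀ q, h q ∈ G₂ q ∧ ‖g q - h q‖ ≤ Metric.hausdorffDist (G₁ q) (G₂ q) := by
  choose h hmem hdist using fun q => (hG₂comp q).exists_infDist_eq_dist (hG₂ne q) (g q)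
  have hdist' : ∀ q, dist (h q) (g q) = Metric.infDist (g q) (G₂ q) := fun q => by
    rw [hdist q, dist_comm]
  have huniq : ∀ q, ∀ x ∈ G₂ q, dist x (g q) ≤ Metric.infDist (g q) (G₂ q) → x = h q :=
    fun q x hx hxd => (hG₂conv q).eq_of_dist_le_infDist hx (hmem q) hxd (hdist' q).le
  refine ⟨h, measurable_of_unique_nearest hG₂comp hG₂meas hgmeas hmem hdist' huniq,
    fun t => ?_, fun q => ⟨hmem q, ?_⟩⟩
  · exact measurable_of_unique_nearest (mX := ℱ t) (fun ω => hG₂comp (t, ω)) (hG₂adap t)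
      (hgadap t) (fun ω => hmem (t, ω)) (fun ω => hdist' (t, ω)) (fun ω => huniq (t, ω))
  · rw [← dist_eq_norm, ← hdist q]
    exact Metric.infDist_le_hausdorffDist_of_mem (hgsel q)
      (Metric.hausdorffEDist_ne_top_of_nonempty_of_bounded (hG₁ne q) (hG₂ne q)
        (hG₁comp q).isBounded (hG₂comp q).isBounded)
end
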